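/- arXiv:1011.1183 — 2 statements merged into one kernel-verified Lean document; each statement's English description precedes it below -/
import Mathlib

section
/- Let G be a group, B ≤ G a subgroup, and 1 → R → Q → S → 1 a central extension of G-groups. If the restriction maps H^1(G,R) → H^1(B,R) and H^1(G,S) → H^1(B,S) are surjective and the restriction map H^2(G,R) → H^2(B,R) is injective, then the restriction map H^1(G,Q) → H^1(B,Q) is surjective. -/
/-- A right action of a group `G` on a group `Q` by group automorphisms,
written `q ↦ q^g` in the paper; here `act q g`. -/
structure GAction (G : Type*) (Q : Type*) [Group G] [Group Q] where
  act : Q → G → Q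
  act_one : ∀ q, act q 1 = q
  act_mul : ∀ q g h, act (act q g) h = act q (g * h)
  act_map_mul : ∀ g q q', act (q * q') g = act q g * act q' g

namespace GAction

variable {G Q : Type*} [Group G] [Group Q]

/-- `γ : G → Q` is a 1-cocycle: `γ(gh) = γ(g)^h · γ(h)`. -/
def IsCocycle (A : GAction G Q) (γ : G → Q) : Prop :=
  ∀ g h : G, γ (g * h) = A.act (γ g) h * γ h

/-- Two 1-cochains are cohomologous: `δ(g) = (q^g)⁻¹ · γ(g) · q` for some `q`. -/
def Cohomologous (A : GAction G Q) (γ δ : G → Q) : Prop :=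
  ∃ q : Q, ∀ g : G, δ g = (A.act q g)⁻¹ * γ g * q

/-- `τ : G × G → Q` is a 2-cocycle: `τ(g,h)^k · τ(gh,k) = τ(h,k) · τ(g,hk)`. -/
def IsTwoCocycle (A : GAction G Q) (τ : G → G → Q) : Prop :=
  ∀ g h k : G, A.act (τ g h) k * τ (g * h) k = τ h k * τ g (h * k)

/-- Two 2-cochains are cohomologous:
`τ'(g,h) = τ(g,h) · φ(g)^h · φ(h) · φ(gh)⁻¹` for some `φ : G → Q`. -/
def TwoCohomologous (A : GAction G Q) (τ τ' : G → G → Q) : Prop :=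
  ∃ φ : G → Q, ∀ g h : G, τ' g h = τ g h * A.act (φ g) h * φ h * (φ (g * h))⁻¹

/-- The restriction of a `G`-action to a subgroup `B ≤ G`. -/
def res (A : GAction G Q) (B : Subgroup G) : GAction B Q where
  act q b := A.act q (b : G)
  act_one q := by simpa using A.act_one q
  act_mul q b c := by simpa using A.act_mul q (b : G) (c : G)
  act_map_mul b q q' := A.act_map_mul (b : G) q q'

end GAction

/-- `1 → R →(ι) Q →(π) S → 1` is a central extension of `G`-groups. -/
structure IsCentralExt {G R Q S : Type*} [Group G] [Group R] [Group Q] [Group S]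
    (AR : GAction G R) (AQ : GAction G Q) (AS : GAction G S)
    (ι : R →* Q) (π : Q →* S) : Prop where
  ι_inj : Function.Injective ι
  π_surj : Function.Surjective π
  exact : ∀ q : Q, π q = 1 ↔ ∃ r : R, ι r = q
  ι_equiv : ∀ (r : R) (g : G), ι (AR.act r g) = AQ.act (ι r) g
  π_equiv : ∀ (q : Q) (g : G), π (AQ.act q g) = AS.act (π q) g
  central : ∀ (r : R) (q : Q), ι r * q = q * ι r

namespace GAction

variable {G Q : Type*} [Group G] [Group Q]

lemma act_map_one (A : GAction G Q) (g : G) : A.act 1 g = 1 := by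
  simpa using A.act_map_mul g 1 1

lemma act_map_inv (A : GAction G Q) (g : G) (q : Q) : A.act q⁻¹ g = (A.act q g)⁻¹ := by
  rw [eq_inv_iff_mul_eq_one, ← A.act_map_mul, inv_mul_cancel, A.act_map_one]

/-- Twisting a cocycle by an element of the coefficient group gives a cocycle. -/
lemma IsCocycle.twist {A : GAction G Q} {γ : G → Q} (hγ : A.IsCocycle γ) (q : Q) :
    A.IsCocycle fun g => A.act q g * γ g * q⁻¹ := by
  intro g h
  simp only [hγ g h, A.act_map_mul, A.act_map_inv, A.act_mul]
  group

end GAction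

namespace IsCentralExt

variable {G R Q S : Type*} [Group G] [Group R] [Group Q] [Group S]
  {AR : GAction G R} {AQ : GAction G Q} {AS : GAction G S} {ι : R →* Q} {π : Q →* S}

lemma mul_comm (hCE : IsCentralExt AR AQ AS ι π) (r r' : R) : r * r' = r' * r :=
  hCE.ι_inj (by simpa using hCE.central r (ι r'))

/-- The factor set of a lift `u : G → Q` of a cocycle `G → S` exists. -/
lemma exists_factorSet (hCE : IsCentralExt AR AQ AS ι π) {u : G → Q}
    (hu : AS.IsCocycle fun g => π (u g)) :
    ∃ τ : G → G → R, ∀ g h, ι (τ g h) * u (g * h) = AQ.act (u g) h * u h := by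
  have key (g h : G) : ∃ r : R, ι r = AQ.act (u g) h * u h * (u (g * h))⁻¹ := by
    refine (hCE.exact _).1 ?_
    have := hu g h
    simp only at this
    simp [hCE.π_equiv, this]
  choose τ hτ using key
  exact ⟨τ, fun g h => by rw [hτ, inv_mul_cancel_right]⟩

/-- The factor set of a lift is a 2-cocycle. -/
lemma isTwoCocycle_factorSet (hCE : IsCentralExt AR AQ AS ι π) {u : G → Q} {τ : G → G → R}
    (hτ : ∀ g h, ι (τ g h) * u (g * h) = AQ.act (u g) h * u h) : AR.IsTwoCocycle τ := by
  intro g h k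
  apply hCE.ι_inj
  apply mul_right_cancel (b := u (g * h * k))
  calc ι (AR.act (τ g h) k * τ (g * h) k) * u (g * h * k)
      = AQ.act (ι (τ g h)) k * (ι (τ (g * h) k) * u (g * h * k)) := by
        rw [map_mul, hCE.ι_equiv, mul_assoc]
    _ = AQ.act (ι (τ g h) * u (g * h)) k * u k := by
        rw [hτ, AQ.act_map_mul, mul_assoc]
    _ = AQ.act (u g) (h * k) * (ι (τ h k) * u (h * k)) := by
        rw [hτ, hτ, AQ.act_map_mul, AQ.act_mul, mul_assoc]
    _ = ι (τ h k) * (AQ.act (u g) (h * k) * u (h * k)) := by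
        rw [← mul_assoc, ← hCE.central, mul_assoc]
    _ = ι (τ h k * τ g (h * k)) * u (g * h * k) := by
        rw [← hτ, map_mul, mul_assoc, mul_assoc g h k]

/-- Correcting a lift by a cochain trivialising its factor set gives a cocycle. -/
lemma isCocycle_mul (hCE : IsCentralExt AR AQ AS ι π) {u : G → Q} {τ : G → G → R} {φ : G → R}
    (hτ : ∀ g h, ι (τ g h) * u (g * h) = AQ.act (u g) h * u h)
    (hφ : ∀ g h, φ (g * h) = τ g h * AR.act (φ g) h * φ h) :
    AQ.IsCocycle fun g => u g * ι (φ g) := by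
  intro g h
  calc u (g * h) * ι (φ (g * h))
      = u (g * h) * ι (τ g h) * ι (AR.act (φ g) h) * ι (φ h) := by
        rw [hφ, map_mul, map_mul]; simp only [mul_assoc]
    _ = AQ.act (u g) h * (u h * ι (AR.act (φ g) h)) * ι (φ h) := by
        rw [← hCE.central (τ g h), hτ, mul_assoc (AQ.act (u g) h)]
    _ = AQ.act (u g * ι (φ g)) h * (u h * ι (φ h)) := by
        rw [← hCE.central (AR.act (φ g) h), hCE.ι_equiv, AQ.act_map_mul]; simp only [mul_assoc]

end IsCentralExt

/-- five lemma for `H¹`, surjectivity. Let `B ≤ G` and let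
`1 → R → Q → S → 1` be a central extension of `G`-groups. If the restriction maps
`H¹(G,R) → H¹(B,R)` and `H¹(G,S) → H¹(B,S)` are surjective and the restriction map
`H²(G,R) → H²(B,R)` is injective, then `H¹(G,Q) → H¹(B,Q)` is surjective. -/
theorem five_lemma_h1_surjective
    {G R Q S : Type*} [Group G] [Group R] [Group Q] [Group S]
    (AR : GAction G R) (AQ : GAction G Q) (AS : GAction G S)
    (ι : R →* Q) (π : Q →* S)
    (hCE : IsCentralExt AR AQ AS ι π) (B : Subgroup G)
    -- `H¹(G,R) → H¹(B,R)` surjective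
    (h2 : ∀ β : B → R, (AR.res B).IsCocycle β →
      ∃ γ : G → R, AR.IsCocycle γ ∧ (AR.res B).Cohomologous (fun b => γ (b : G)) β)
    -- `H¹(G,S) → H¹(B,S)` surjective
    (h4 : ∀ β : B → S, (AS.res B).IsCocycle β →
      ∃ γ : G → S, AS.IsCocycle γ ∧ (AS.res B).Cohomologous (fun b => γ (b : G)) β)
    -- `H²(G,R) → H²(B,R)` injective
    (h5 : ∀ τ τ' : G → G → R, AR.IsTwoCocycle τ → AR.IsTwoCocycle τ' →
      (AR.res B).TwoCohomologous (fun b c => τ (b : G) (c : G))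
        (fun b c => τ' (b : G) (c : G)) →
      AR.TwoCohomologous τ τ') :
    -- `H¹(G,Q) → H¹(B,Q)` surjective
    ∀ β : B → Q, (AQ.res B).IsCocycle β →
      ∃ γ : G → Q, AQ.IsCocycle γ ∧ (AQ.res B).Cohomologous (fun b => γ (b : G)) β := by
  classical
  intro β hβ
  obtain ⟨σ, hσ, s, hs⟩ := h4 (fun b => π (β b)) fun b c => by
    simp only [hβ b c, map_mul]
    exact congrArg (· * π (β c)) (hCE.π_equiv _ _)
  obtain ⟨q, rfl⟩ := hCE.π_surj s
  set β' : B → Q := fun b => AQ.act q b * β b * q⁻¹ with hβ'_def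
  have hβ' : (AQ.res B).IsCocycle β' := hβ.twist q
  have hπβ' (b : B) : π (β' b) = σ b := by
    have h := hs b
    change π (β b) = (AS.act (π q) b)⁻¹ * σ b * π q at h
    simp only [hβ'_def, map_mul, map_inv, hCE.π_equiv, h]
    group
  -- a lift of `σ` to `Q` extending `β'`
  obtain ⟨u, hπu, huB⟩ : ∃ u : G → Q, (∀ g, π (u g) = σ g) ∧ ∀ b : B, u b = β' b := by
    refine ⟨fun g => if hg : g ∈ B then β' ⟨g, hg⟩ else (hCE.π_surj (σ g)).choose, ?_, ?_⟩
    · intro g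
      by_cases hg : g ∈ B
      · simpa [hg] using hπβ' ⟨g, hg⟩
      · simpa [hg] using (hCE.π_surj (σ g)).choose_spec
    · intro b
      simp
  obtain ⟨τ, hτ⟩ := hCE.exists_factorSet (u := u) (by simpa only [hπu] using hσ)
  have hτB (b c : B) : τ b c = 1 := by
    apply hCE.ι_inj
    have h := hτ b c
    have h' : u ((b : G) * c) = AQ.act (u b) c * u c := by
      rw [huB, huB, ← B.coe_mul, huB]
      exact hβ' b c
    rw [← h'] at h
    rw [map_one]
    exact mul_eq_right.1 h
  obtain ⟨φ, hφ⟩ := h5 τ (fun _ _ => 1) (hCE.isTwoCocycle_factorSet hτ)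
    (fun g h k => by simp [AR.act_map_one])
    ⟨fun _ => 1, fun b c => by
      simp [hτB, (AR.res B).act_map_one]⟩
  replace hφ (g h : G) : φ (g * h) = τ g h * AR.act (φ g) h * φ h :=
    (mul_inv_eq_one.1 (hφ g h).symm).symm
  obtain ⟨δ, hδ, r, hr⟩ := h2 (fun b => φ b) fun b c => by
    have h := hφ b c
    rwa [hτB, one_mul] at h
  have hψ (g h : G) : φ (g * h) * (δ (g * h))⁻¹ =
      τ g h * AR.act (φ g * (δ g)⁻¹) h * (φ h * (δ h)⁻¹) := by
    rw [hφ, hδ, mul_inv_rev, hCE.mul_comm (δ h)⁻¹, AR.act_map_mul, AR.act_map_inv]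
    simp only [mul_assoc]
    rw [← mul_assoc (φ h), hCE.mul_comm (φ h), mul_assoc]
  refine ⟨_, hCE.isCocycle_mul (φ := fun g => φ g * (δ g)⁻¹) hτ hψ, ι r⁻¹ * q, fun b => ?_⟩
  have hrb : φ b = (AR.act r b)⁻¹ * δ b * r := hr b
  have hιψ : φ b * (δ b)⁻¹ = (AR.act r b)⁻¹ * r := by
    rw [hrb, mul_assoc _ (δ b), hCE.mul_comm (δ b), ← mul_assoc, mul_inv_cancel_right]
  change β b = (AQ.act (ι r⁻¹ * q) b)⁻¹ * (u b * ι (φ b * (δ b)⁻¹)) * (ι r⁻¹ * q)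
  have hx : ι (AR.act r b) * (AQ.act q b * β b * q⁻¹) =
      AQ.act q b * β b * q⁻¹ * ι (AR.act r b) := hCE.central _ _
  calc β b = (AQ.act q b)⁻¹ * (AQ.act q b * β b * q⁻¹ * ι (AR.act r b)) *
        (ι (AR.act r b))⁻¹ * q := by group
    _ = _ := by
      rw [← hx, hιψ, huB, AQ.act_map_mul, ← hCE.ι_equiv, AR.act_map_inv]
      simp only [hβ'_def, map_mul, map_inv]
      group
end

section
/- Let G be a group, B ≤ G a subgroup, and 1 → R → Q →(π) S → 1 a central extension of G-groups. Suppose the restriction maps H^1(G,R) → H^1(B,R) and H^1(G,S) → H^1(B,S) are injective, and that for every γ ∈ Z^1(G,S), writing β = γ|_B, the restriction map (S_γ)^G → (S_β)^B on twisted fixed points is surjective. Then the restriction map H^1(G,Q) → H^1(B,Q) is injective. -/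
namespace GAction

variable {G Q : Type*} [Group G] [Group Q] (A : GAction G Q)

theorem map_one_act (g : G) : A.act 1 g = 1 := by
  simpa using A.act_map_mul g 1 1

theorem map_inv_act (q : Q) (g : G) : A.act q⁻¹ g = (A.act q g)⁻¹ := by
  rw [eq_inv_iff_mul_eq_one, ← A.act_map_mul, inv_mul_cancel, A.map_one_act]

theorem isCocycle_one : A.IsCocycle fun _ => 1 := fun _ h => by
  simp [A.map_one_act]

variable {A}

/-- Cochains cohomologous to a cocycle are cocycles. -/
theorem IsCocycle.conj {γ : G → Q} (hγ : A.IsCocycle γ) (q : Q) :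
    A.IsCocycle fun g => (A.act q g)⁻¹ * γ g * q := fun g h => by
  simp only [hγ g h, A.act_map_mul, A.map_inv_act, A.act_mul]
  group

end GAction

/-- With `x = s^g`, `y = p^g` and `c = γ g`: the conjugates of `γ` by `s` and by `p` agree at `g`
iff `s⁻¹ * p` is fixed by `g` for the action twisted by the conjugate of `γ` by `s`. -/
theorem twisted_fixed_iff {S : Type*} [Group S] {c d s p x y : S} (hd : d = x⁻¹ * c * s) :
    d⁻¹ * (x⁻¹ * y) * d = s⁻¹ * p ↔ d = y⁻¹ * c * p := by
  have key : d⁻¹ * (x⁻¹ * y) * d = s⁻¹ * (c⁻¹ * (y * d)) := by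
    rw [show d⁻¹ = s⁻¹ * c⁻¹ * x by rw [hd]; group]
    group
  rw [key, mul_right_inj, inv_mul_eq_iff_eq_mul, mul_assoc, eq_inv_mul_iff_mul_eq]

namespace IsCentralExt

variable {G R Q S : Type*} [Group G] [Group R] [Group Q] [Group S]
  {AR : GAction G R} {AQ : GAction G Q} {AS : GAction G S} {ι : R →* Q} {π : Q →* S}

theorem isCocycle_map (hCE : IsCentralExt AR AQ AS ι π) {γ : G → Q} (hγ : AQ.IsCocycle γ) :
    AS.IsCocycle fun g => π (γ g) := fun g h => by
  simp only [hγ g h, map_mul, hCE.π_equiv]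

/-- Two cocycles with the same image in `S` differ by a cocycle with values in `R`. -/
theorem exists_isCocycle_of_map_eq (hCE : IsCentralExt AR AQ AS ι π) {γ δ : G → Q}
    (hγ : AQ.IsCocycle γ) (hδ : AQ.IsCocycle δ) (h : ∀ g, π (γ g) = π (δ g)) :
    ∃ r : G → R, AR.IsCocycle r ∧ ∀ g, δ g = γ g * ι (r g) := by
  have hr : ∀ g, ∃ r : R, ι r = (γ g)⁻¹ * δ g := fun g =>
    (hCE.exact _).1 (by rw [map_mul, map_inv, h, inv_mul_cancel])
  choose r hr using hr
  have hδr : ∀ g, δ g = γ g * ι (r g) := fun g => by rw [hr, mul_inv_cancel_left]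
  refine ⟨r, fun g k => hCE.ι_inj ?_, hδr⟩
  rw [hr, hδ, hγ, hδr g, hδr k, AQ.act_map_mul, ← hCE.ι_equiv, map_mul,
    mul_assoc (AQ.act (γ g) k), ← mul_assoc (ι _) (γ k), hCE.central _ (γ k)]
  group

end IsCentralExt


/-- five lemma for `H¹`, injectivity. Let `B ≤ G` and let
`1 → R → Q →(π) S → 1` be a central extension of `G`-groups. If the restriction maps
`H¹(G,R) → H¹(B,R)` and `H¹(G,S) → H¹(B,S)` are injective, and for every
`γ ∈ Z¹(G,S)` (with `β = γ|_B`) the restriction map `(S_γ)^G → (S_β)^B` on twisted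
fixed points is surjective, then `H¹(G,Q) → H¹(B,Q)` is injective. -/
theorem five_lemma_h1_injective
    {G R Q S : Type*} [Group G] [Group R] [Group Q] [Group S]
    (AR : GAction G R) (AQ : GAction G Q) (AS : GAction G S)
    (ι : R →* Q) (π : Q →* S)
    (hCE : IsCentralExt AR AQ AS ι π) (B : Subgroup G)
    -- `H¹(G,R) → H¹(B,R)` injective
    (h2 : ∀ γ δ : G → R, AR.IsCocycle γ → AR.IsCocycle δ →
      (AR.res B).Cohomologous (fun b => γ (b : G)) (fun b => δ (b : G)) →
      AR.Cohomologous γ δ)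
    -- `H¹(G,S) → H¹(B,S)` injective
    (h4 : ∀ γ δ : G → S, AS.IsCocycle γ → AS.IsCocycle δ →
      (AS.res B).Cohomologous (fun b => γ (b : G)) (fun b => δ (b : G)) →
      AS.Cohomologous γ δ)
    -- for every `γ ∈ Z¹(G,S)`, the inclusion `(S_γ)^G ⊆ (S_{γ|_B})^B` is onto
    (hfix : ∀ γ : G → S, AS.IsCocycle γ → ∀ s : S,
      (∀ b : B, (γ (b : G))⁻¹ * AS.act s (b : G) * γ (b : G) = s) →
      ∀ g : G, (γ g)⁻¹ * AS.act s g * γ g = s) :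
    -- `H¹(G,Q) → H¹(B,Q)` injective
    ∀ γ δ : G → Q, AQ.IsCocycle γ → AQ.IsCocycle δ →
      (AQ.res B).Cohomologous (fun b => γ (b : G)) (fun b => δ (b : G)) →
      AQ.Cohomologous γ δ := by
  rintro γ δ hγ hδ ⟨q, hq⟩
  change ∀ b : B, δ b = (AQ.act q b)⁻¹ * γ b * q at hq
  have hqS (b : B) : π (δ b) = (AS.act (π q) b)⁻¹ * π (γ b) * π q := by
    simp only [hq, map_mul, map_inv, hCE.π_equiv]
  obtain ⟨s, hs⟩ := h4 (fun g => π (γ g)) (fun g => π (δ g))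
    (hCE.isCocycle_map hγ) (hCE.isCocycle_map hδ) ⟨π q, hqS⟩
  have hact (g : G) : AS.act (s⁻¹ * π q) g = (AS.act s g)⁻¹ * AS.act (π q) g := by
    rw [AS.act_map_mul, AS.map_inv_act]
  have hπ (g : G) : π ((AQ.act q g)⁻¹ * γ g * q) = π (δ g) := by
    have hu := hfix _ (hCE.isCocycle_map hδ) (s⁻¹ * π q)
      (fun b => by rw [hact]; exact (twisted_fixed_iff (hs b)).2 (hqS b)) g
    rw [hact] at hu
    simpa only [map_mul, map_inv, hCE.π_equiv] using ((twisted_fixed_iff (hs g)).1 hu).symm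
  obtain ⟨r, hr, hδr⟩ := hCE.exists_isCocycle_of_map_eq (hγ.conj q) hδ hπ
  have hrB (b : B) : r b = 1 := hCE.ι_inj <| by
    rw [map_one]
    exact mul_eq_left.1 ((hδr b).symm.trans (hq b))
  obtain ⟨ρ, hρ⟩ := h2 _ r AR.isCocycle_one hr
    ⟨1, fun b => by simp [hrB, GAction.map_one_act]⟩
  refine ⟨q * ι ρ, fun g => ?_⟩
  rw [hδr, hρ, AQ.act_map_mul, ← hCE.ι_equiv, mul_one, map_mul, ← mul_assoc,
    ← hCE.central (AR.act ρ g)⁻¹, map_inv, mul_inv_rev]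
  group
end
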